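/- Let (Δ, c⃗, ε⃗) be a semitoric polygon representative with hidden and Delzant corners p₁, …, p_d labeled clockwise and ℓᵢ the SL₂(ℤ)-length of the semitoric edge from pᵢ to pᵢ₊₁ (indices cyclic). Let P = ∪ᵢ Bᵢ be a semitoric packing with Bᵢ packed at pᵢ (possibly empty) and λᵢ the SL₂(ℤ)-size of Bᵢ (λᵢ = 0 if Bᵢ is empty). Then λᵢ + λᵢ₊₁ ≤ ℓᵢ for all i ∈ {1, …, d}. -/

import Mathlib

open Matrix MeasureTheory Set

/-- Points of the plane. -/
abbrev Pt := Fin 2 → ℝ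

/-- The action of `SL₂(ℤ)` on `ℝ²` by matrix-vector multiplication. -/
noncomputable def sl2Apply (M : Matrix.SpecialLinearGroup (Fin 2) ℤ) (x : Pt) : Pt :=
  ((M : Matrix (Fin 2) (Fin 2) ℤ).map (Int.cast : ℤ → ℝ)).mulVec x

/-- The model triangle `B(λ) = {(x,y) : x ≥ 0, y ≥ 0, x + y < λ}`. -/
def modelTriangle (lam : ℝ) : Set Pt :=
  {x | 0 ≤ x 0 ∧ 0 ≤ x 1 ∧ x 0 + x 1 < lam}

/-- The area (Lebesgue measure) of a subset of the plane. -/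
noncomputable def area (S : Set Pt) : ℝ := (volume S).toReal

/-- The element of the group `𝒯 × G_m` determined by a global power `n` of
`T = [[1,0],[1,1]]`, a vertical translation `t`, and cut flips `u` (with `u j ∈ {0, ε_j}`;
flipping the cut at the marked point `c j` applies `T^{± 1}` on the half-plane to its
right), as a piecewise affine map of the plane. -/
noncomputable def stMap {m : ℕ} (c : Fin m → Pt) (n : ℤ) (t : ℝ) (u : Fin m → ℤ)
    (x : Pt) : Pt :=
  ![x 0, x 1 + (n : ℝ) * x 0 + t + ∑ j, (u j : ℝ) * max (x 0 - c j 0) 0]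

/-- `B` is an admissibly packed triangle of `SL₂(ℤ)`-size `lam` at the point `p` of the
semitoric polygon with underlying set `Δ`, marked points `c` and cut directions `eps`:
in some equivalent representative (image under an element `σ` of `𝒯 × G_m`), `σ(B)` has
the form `M(B(lam)) + σ(p)` with `M ∈ SL₂(ℤ)`, coincides with the polygon near `σ(p)`,
and contains no marked point. -/
def IsSTPackedTriangleIn {m : ℕ} (Δ : Set Pt) (c : Fin m → Pt) (eps : Fin m → ℤ)
    (p : Pt) (lam : ℝ) (B : Set Pt) : Prop :=
  0 < lam ∧ B ⊆ Δ ∧ (∀ j, c j ∉ B) ∧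
  ∃ (n : ℤ) (t : ℝ) (u : Fin m → ℤ), (∀ j, u j = 0 ∨ u j = eps j) ∧
    (∃ M : Matrix.SpecialLinearGroup (Fin 2) ℤ,
        stMap c n t u '' B =
          (fun x => sl2Apply M x + stMap c n t u p) '' modelTriangle lam) ∧
    ∃ U : Set Pt, IsOpen U ∧ stMap c n t u p ∈ U ∧
      (stMap c n t u '' B) ∩ U = (stMap c n t u '' Δ) ∩ U

/-- `P` is a semitoric packing of the semitoric polygon `(Δ, c, eps)`: a finite union of
pairwise disjoint admissibly packed triangles, at most one at each vertex. -/
def IsSTPackingIn {m : ℕ} (Δ : Set Pt) (c : Fin m → Pt) (eps : Fin m → ℤ)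
    (P : Set Pt) : Prop :=
  ∃ (N : ℕ) (pt : Fin N → Pt) (lam : Fin N → ℝ) (tri : Fin N → Set Pt),
    P = (⋃ a, tri a) ∧ Function.Injective pt ∧
    (∀ a, pt a ∈ Set.extremePoints ℝ Δ) ∧
    (∀ a, IsSTPackedTriangleIn Δ c eps (pt a) (lam a) (tri a)) ∧
    Pairwise (Function.onFun Disjoint tri)

/-- The set of densities `area P / area Δ` of semitoric packings `P` of `(Δ, c, eps)`;
the semitoric packing density `ρ_ST` is its supremum. -/
def stDensitySet {m : ℕ} (Δ : Set Pt) (c : Fin m → Pt) (eps : Fin m → ℤ) : Set ℝ :=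
  {r : ℝ | ∃ P, IsSTPackingIn Δ c eps P ∧ r = area P / area Δ}

/-- The determinant of a pair of integer vectors in the plane. -/
def detZ (u v : Fin 2 → ℤ) : ℤ := u 0 * v 1 - u 1 * v 0

/-- The matrix `Tⁿ`, where `T = [[1,0],[1,1]]`. -/
def Tpow (n : ℤ) : Matrix (Fin 2) (Fin 2) ℤ := !![1, 0; n, 1]

/-- The combinatorial data of a semitoric polygon representative: a convex polygon with
vertices `V i` listed in clockwise order, the edge from `V i` to `V (i+1)` directed along
the primitive integer vector `dir i` with `SL₂(ℤ)`-length `len i`, together with marked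
points `c j` and cut directions `eps j ∈ {±1}`. -/
structure STRep (d m : ℕ) where
  V : Fin d → Pt
  dir : Fin d → Fin 2 → ℤ
  len : Fin d → ℝ
  c : Fin m → Pt
  eps : Fin m → ℤ

namespace STRep

variable {d m : ℕ}

/-- The underlying polygon (as a subset of the plane). -/
noncomputable def carrier (R : STRep d m) : Set Pt := convexHull ℝ (Set.range R.V)

/-- The cut of the marked point `c j` (the vertical ray from `c j` in the direction
`eps j`) meets the boundary of the polygon at the point `z`. -/
def CutHits (R : STRep d m) (j : Fin m) (z : Pt) : Prop :=
  z ∈ frontier R.carrier ∧ z 0 = R.c j 0 ∧ 0 ≤ (R.eps j : ℝ) * (z 1 - R.c j 1)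

/-- The number of cuts meeting the boundary of the polygon at the vertex `V i`. -/
noncomputable def numCuts (R : STRep d m) (i : Fin d) : ℕ :=
  Set.ncard {j | R.CutHits j (R.V i)}

/-- The first primitive integer vector emanating from the vertex `V i`
(so that `det (u1, u2) > 0` for a clockwise polygon). -/
def u1 [NeZero d] (R : STRep d m) (i : Fin d) : Fin 2 → ℤ := fun k => - R.dir (i - 1) k

/-- The second primitive integer vector emanating from the vertex `V i`. -/
def u2 (R : STRep d m) (i : Fin d) : Fin 2 → ℤ := R.dir i

/-- The vertex `V i` is a fake corner: at least one cut meets it and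
`det (u₁, Tᵏ u₂) = 0` where `k` is the number of cuts meeting it. -/
def IsFakeCorner [NeZero d] (R : STRep d m) (i : Fin d) : Prop :=
  0 < R.numCuts i ∧ detZ (R.u1 i) ((Tpow (R.numCuts i : ℤ)).mulVec (R.u2 i)) = 0

/-- The vertex `V i` is a hidden or Delzant corner (i.e. not a fake corner). -/
def IsHDCorner [NeZero d] (R : STRep d m) (i : Fin d) : Prop := ¬ R.IsFakeCorner i

/-- `R` is a valid semitoric polygon representative: the polygon is convex and rational
with vertices in clockwise order, the marked points lie in the interior, the cut
directions are `±1`, every point where exactly `k ≥ 1` cuts meet the boundary is a vertex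
satisfying the fake (`det (u₁, Tᵏ u₂) = 0`) or hidden (`det (u₁, Tᵏ u₂) = 1`) corner
condition, and every other vertex satisfies the Delzant condition
`det (u₁, u₂) = ±1`. -/
structure IsValid [NeZero d] (R : STRep d m) : Prop where
  three_le : 3 ≤ d
  len_pos : ∀ i, 0 < R.len i
  primitive : ∀ i, Int.gcd (R.dir i 0) (R.dir i 1) = 1
  edge_eq : ∀ i k, R.V (i + 1) k - R.V i k = R.len i * (R.dir i k : ℝ)
  clockwise : ∀ i, detZ (R.dir i) (R.dir (i + 1)) < 0
  edges_boundary : ∀ i, segment ℝ (R.V i) (R.V (i + 1)) ⊆ frontier R.carrier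
  marked_interior : ∀ j, R.c j ∈ interior R.carrier
  eps_pm : ∀ j, R.eps j = 1 ∨ R.eps j = -1
  cuts_at_vertices : ∀ j z, R.CutHits j z → ∃ i, z = R.V i
  corner_delzant : ∀ i, R.numCuts i = 0 →
    detZ (R.u1 i) (R.u2 i) = 1 ∨ detZ (R.u1 i) (R.u2 i) = -1
  corner_cut : ∀ i, 0 < R.numCuts i →
    detZ (R.u1 i) ((Tpow (R.numCuts i : ℤ)).mulVec (R.u2 i)) = 0 ∨
    detZ (R.u1 i) ((Tpow (R.numCuts i : ℤ)).mulVec (R.u2 i)) = 1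

end STRep

/-- An admissibly packed triangle in the semitoric polygon representative `R`. -/
def IsSTPackedTriangle {d m : ℕ} (R : STRep d m) (p : Pt) (lam : ℝ) (B : Set Pt) :
    Prop :=
  IsSTPackedTriangleIn R.carrier R.c R.eps p lam B

/-- `g` enumerates the hidden and Delzant corners of `R` in (clockwise) cyclic order:
`g` is strictly monotone and its range is exactly the set of hidden/Delzant corners. -/
def IsCornerEnum {d m D : ℕ} [NeZero d] (R : STRep d m) (g : Fin D → Fin d) : Prop :=
  StrictMono g ∧ ∀ i, R.IsHDCorner i ↔ ∃ a, g a = i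

/-- `P` is a semitoric packing of `R` whose triangle at the hidden/Delzant corner
`V (g a)` has `SL₂(ℤ)`-size `sz a` (with `sz a = 0` if no triangle is packed there). -/
def IsSTPacking {d m D : ℕ} (R : STRep d m) (g : Fin D → Fin d)
    (sz : Fin D → ℝ) (P : Set Pt) : Prop :=
  ∃ tri : Fin D → Set Pt,
    P = (⋃ a, tri a) ∧
    (∀ a, (sz a = 0 ∧ tri a = ∅) ∨
       IsSTPackedTriangle R (R.V (g a)) (sz a) (tri a)) ∧
    Pairwise (Function.onFun Disjoint tri)

/-- The number of steps from `s` to `i` going cyclically forwards in `Fin d`. -/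
def distCyc {d : ℕ} (s i : Fin d) : ℕ := (i.val + d - s.val) % d

/-- The number of edges in the cyclic chain of edges from vertex `s` to vertex `e`
(the whole cycle when `e = s`). -/
def chainLen {d : ℕ} (s e : Fin d) : ℕ := if e = s then d else distCyc s e

/-- The `SL₂(ℤ)`-length `ℓ_a` of the `a`-th semitoric edge: the sum of the
`SL₂(ℤ)`-lengths of the edges in the chain (joined at fake corners) connecting the
hidden/Delzant corner `V (g a)` to the next one `V (g (a+1))`. -/
noncomputable def stEdgeLen {d m D : ℕ} [NeZero D] (R : STRep d m) (g : Fin D → Fin d)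
    (a : Fin D) : ℝ :=
  ∑ i : Fin d, if distCyc (g a) i < chainLen (g a) (g (a + 1)) then R.len i else 0

/-- The point `q` lies on one of the two semitoric edges emanating from the
hidden/Delzant corner `V (g a)`, and `t` is the `SL₂(ℤ)`-length of the boundary path
(contained in that single semitoric edge) from `V (g a)` to `q`. -/
def OnEmanating {d m D : ℕ} [NeZero D] (R : STRep d m) (g : Fin D → Fin d)
    (a : Fin D) (q : Pt) (t : ℝ) : Prop :=
  (∃ (i : Fin d) (s : ℝ), distCyc (g a) i < chainLen (g a) (g (a + 1)) ∧
      0 ≤ s ∧ s ≤ R.len i ∧ (∀ k, q k = R.V i k + s * (R.dir i k : ℝ)) ∧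
      t = (∑ i' : Fin d, if distCyc (g a) i' < distCyc (g a) i then R.len i' else 0) + s) ∨
  (∃ (i : Fin d) (s : ℝ), distCyc (g (a - 1)) i < chainLen (g (a - 1)) (g a) ∧
      0 ≤ s ∧ s ≤ R.len i ∧ (∀ k, q k = R.V i k + s * (R.dir i k : ℝ)) ∧
      t = (∑ i' : Fin d, if distCyc (g (a - 1)) i < distCyc (g (a - 1)) i' ∧
              distCyc (g (a - 1)) i' < chainLen (g (a - 1)) (g a) then R.len i' else 0)
          + (R.len i - s))

/-- `lam ≤ α_a`, where `α_a` is the marked-point bound at the hidden/Delzant corner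
`V (g a)`: for each marked point `c j` whose vertical line meets a semitoric edge
emanating from `V (g a)`, taking the intersection point `q` whose boundary path from the
corner has minimal `SL₂(ℤ)`-length `t`, one has `lam ≤ t + b · |v₁ − w₁|`, where `b` is
the vertical distance from `c j` to `q` and `v, w` are the primitive integer vectors
directing the edges emanating from the corner. (`α_a = ∞` when there is no such marked
point, in which case this is no condition.) -/
def AlphaBound {d m D : ℕ} [NeZero d] [NeZero D] (R : STRep d m) (g : Fin D → Fin d)
    (a : Fin D) (lam : ℝ) : Prop :=
  ∀ (j : Fin m) (q : Pt) (t : ℝ),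
    OnEmanating R g a q t → q 0 = R.c j 0 →
    (∀ (q' : Pt) (t' : ℝ), OnEmanating R g a q' t' → q' 0 = R.c j 0 → t ≤ t') →
    lam ≤ t + |q 1 - R.c j 1| * |((R.dir (g a) 0 + R.dir (g a - 1) 0 : ℤ) : ℝ)|

/-- The polytope `𝒫̃_ST` of admissible size tuples:
`sz a ≥ 0`, `sz a + sz (a+1) ≤ ℓ_a` and `sz a ≤ α_a` for all `a` (cyclically). -/
def STPolytope {d m D : ℕ} [NeZero d] [NeZero D] (R : STRep d m)
    (g : Fin D → Fin d) : Set (Fin D → ℝ) :=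
  {sz | ∀ a, 0 ≤ sz a ∧ sz a + sz (a + 1) ≤ stEdgeLen R g a ∧ AlphaBound R g a (sz a)}

namespace STRep

variable {d m : ℕ}

lemma V_mem_carrier (R : STRep d m) (i : Fin d) : R.V i ∈ R.carrier :=
  subset_convexHull ℝ _ (mem_range_self i)

lemma convex_carrier (R : STRep d m) : Convex ℝ R.carrier := convex_convexHull ℝ _

lemma isClosed_carrier (R : STRep d m) : IsClosed R.carrier :=
  (Set.finite_range R.V).isClosed_convexHull ℝ

lemma IsValid.V_succ [NeZero d] {R : STRep d m} (hR : R.IsValid) (i : Fin d) (k : Fin 2) :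
    R.V (i + 1) k = R.V i k + R.len i * (R.dir i k : ℝ) := by
  linarith [hR.edge_eq i k]

lemma IsValid.clockwise_real [NeZero d] {R : STRep d m} (hR : R.IsValid) (i : Fin d) :
    (R.dir i 0 : ℝ) * R.dir (i + 1) 1 - R.dir i 1 * R.dir (i + 1) 0 < 0 := by
  have := hR.clockwise i
  unfold detZ at this
  exact_mod_cast this

lemma IsValid.interior_carrier_nonempty [NeZero d] {R : STRep d m} (hR : R.IsValid) :
    (interior R.carrier).Nonempty := by
  set i : Fin d := 0
  set P := R.V i with hP
  set e : Pt := fun k => R.len i * R.dir i k with he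
  set f : Pt := fun k => R.len (i + 1) * R.dir (i + 1) k with hf
  have hK : e 0 * f 1 - e 1 * f 0 < 0 := by
    have h1 := hR.clockwise_real i
    have h2 := mul_pos (hR.len_pos i) (hR.len_pos (i + 1))
    simp only [he, hf]
    nlinarith
  set K := e 0 * f 1 - e 1 * f 0 with hKdef
  let α : Pt → ℝ := fun z => ((z 0 - P 0) * f 1 - (z 1 - P 1) * f 0) / K
  let β : Pt → ℝ := fun z => (e 0 * (z 1 - P 1) - e 1 * (z 0 - P 0)) / K
  have hα : Continuous α := by fun_prop
  have hβ : Continuous β := by fun_prop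
  have hO : IsOpen {z | 0 < β z ∧ β z < α z ∧ α z < 1} :=
    (isOpen_lt continuous_const hβ).inter
      ((isOpen_lt hβ hα).inter (isOpen_lt hα continuous_const))
  have hsub : {z | 0 < β z ∧ β z < α z ∧ α z < 1} ⊆ R.carrier := by
    rintro z ⟨h1, h2, h3⟩
    have hz : z = (1 - α z) • R.V i + (α z - β z) • R.V (i + 1) + β z • R.V (i + 1 + 1) := by
      have hV1 : ∀ k, R.V (i + 1) k = P k + e k := fun k => hR.V_succ i k
      have hV2 : ∀ k, R.V (i + 1 + 1) k = P k + e k + f k := fun k => by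
        rw [hR.V_succ (i + 1) k, hV1]
      ext k
      simp only [Pi.add_apply, Pi.smul_apply, smul_eq_mul, hV1, hV2, ← hP]
      have hne : K ≠ 0 := hK.ne
      fin_cases k
      · simp only [α, β, Fin.zero_eta]
        field_simp
        rw [hKdef]; ring
      · simp only [α, β, Fin.mk_one]
        field_simp
        rw [hKdef]; ring
    rw [hz]
    have key := R.convex_carrier.sum_mem (t := Finset.univ)
      (w := ![1 - α z, α z - β z, β z]) (z := ![R.V i, R.V (i + 1), R.V (i + 1 + 1)])
      (by intro k _; fin_cases k <;> simp <;> linarith)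
      (by simp [Fin.sum_univ_three])
      (by intro k _; fin_cases k <;> simp [V_mem_carrier])
    simpa [Fin.sum_univ_three] using key
  refine ⟨P + (2 / 3 : ℝ) • e + (1 / 3 : ℝ) • f, interior_maximal hsub hO ?_⟩
  have ha : α (P + (2 / 3 : ℝ) • e + (1 / 3 : ℝ) • f) = 2 / 3 := by
    simp only [α, Pi.add_apply, Pi.smul_apply, smul_eq_mul]
    rw [div_eq_iff hK.ne, hKdef]; ring
  have hb : β (P + (2 / 3 : ℝ) • e + (1 / 3 : ℝ) • f) = 1 / 3 := by
    simp only [β, Pi.add_apply, Pi.smul_apply, smul_eq_mul]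
    rw [div_eq_iff hK.ne, hKdef]; ring
  simp only [mem_ofPred_eq, ha, hb]
  norm_num

lemma IsValid.edgePoint_mem_frontier [NeZero d] {R : STRep d m} (hR : R.IsValid) (i : Fin d)
    {t : ℝ} (h0 : 0 ≤ t) (h1 : t ≤ R.len i) :
    (fun k => R.V i k + t * (R.dir i k : ℝ)) ∈ frontier R.carrier := by
  apply hR.edges_boundary i
  have hl := hR.len_pos i
  refine ⟨1 - t / R.len i, t / R.len i, ?_, by positivity, by ring, ?_⟩
  · rw [sub_nonneg, div_le_one hl]; exact h1
  · ext k
    simp only [Pi.add_apply, Pi.smul_apply, smul_eq_mul, hR.V_succ]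
    field_simp
    ring

/-- A convex polygon lies on the inner side of each of its edges. -/
lemma IsValid.edge_halfPlane [NeZero d] {R : STRep d m} (hR : R.IsValid) (i : Fin d)
    {z : Pt} (hz : z ∈ R.carrier) :
    (R.dir i 0 : ℝ) * (z 1 - R.V i 1) - R.dir i 1 * (z 0 - R.V i 0) ≤ 0 := by
  have hl := hR.len_pos i
  set q : Pt := fun k => R.V i k + (R.len i / 2) * (R.dir i k : ℝ) with hq
  have hqf : q ∈ frontier R.carrier :=
    hR.edgePoint_mem_frontier i (by positivity) (by linarith)
  obtain ⟨f, hf⟩ := geometric_hahn_banach_open_point R.convex_carrier.interior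
    isOpen_interior hqf.2
  have hle : ∀ z ∈ R.carrier, f z ≤ f q := by
    have hcl := R.convex_carrier.closure_interior_eq_closure_of_nonempty_interior
      hR.interior_carrier_nonempty
    have : closure (interior R.carrier) ⊆ {z | f z ≤ f q} :=
      closure_minimal (fun z hz => (hf z hz).le) (isClosed_le f.continuous continuous_const)
    intro z hz
    exact this (hcl ▸ subset_closure hz)
  have hexp : ∀ x : Pt, f x = x 0 * f ![1, 0] + x 1 * f ![0, 1] := by
    intro x
    rw [← smul_eq_mul, ← smul_eq_mul, ← map_smul, ← map_smul, ← map_add]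
    congr 1
    ext k
    fin_cases k <;> simp
  set A := f ![1, 0]
  set B := f ![0, 1]
  obtain ⟨w, hw⟩ := hR.interior_carrier_nonempty
  have hw' := hf w hw
  have h0 := hle _ (R.V_mem_carrier i)
  have h1 := hle _ (R.V_mem_carrier (i + 1))
  have h2 := hle _ (R.V_mem_carrier (i + 1 + 1))
  have hz' := hle z hz
  rw [hexp, hexp q] at h0 h1 h2 hw' hz'
  simp only [hR.V_succ, hq] at h0 h1 h2 hw' hz'
  have hcw := hR.clockwise_real i
  have hl2 := hR.len_pos (i + 1)
  set a := (R.dir i 0 : ℝ)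
  set b := (R.dir i 1 : ℝ)
  set a' := (R.dir (i + 1) 0 : ℝ)
  set b' := (R.dir (i + 1) 1 : ℝ)
  have hpar : a * A + b * B = 0 := by
    have h3 : 0 ≤ R.len i / 2 * (a * A + b * B) := by linarith
    have h4 : R.len i / 2 * (a * A + b * B) ≤ 0 := by linarith
    have := le_antisymm h4 h3
    rcases mul_eq_zero.mp this with h | h
    · linarith
    · exact h
  have hnext : a' * A + b' * B ≤ 0 := by
    have h5 : R.len (i + 1) * (a' * A + b' * B) + R.len i / 2 * (a * A + b * B) ≤ 0 := by
      linarith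
    rw [hpar] at h5
    nlinarith
  have hmain : (z 0 - R.V i 0) * A + (z 1 - R.V i 1) * B ≤ 0 := by
    have : (z 0 - R.V i 0) * A + (z 1 - R.V i 1) * B ≤ R.len i / 2 * (a * A + b * B) := by
      linarith
    rwa [hpar, mul_zero] at this
  have hAB : A ≠ 0 ∨ B ≠ 0 := by
    by_contra h
    push Not at h
    rw [h.1, h.2] at hw'
    simp at hw'
  set X := z 0 - R.V i 0
  set Y := z 1 - R.V i 1
  by_contra! hcon
  -- the functional is a positive multiple of the determinant against the edge direction
  have e1 : A * (a * b' - b * a') = -b * (a' * A + b' * B) + b' * (a * A + b * B) := by ring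
  have e2 : B * (a * b' - b * a') = a * (a' * A + b' * B) - a' * (a * A + b * B) := by ring
  rw [hpar] at e1 e2
  have e3 : (X * A + Y * B) * (a * b' - b * a') = (a * Y - b * X) * (a' * A + b' * B) := by
    linear_combination X * e1 + Y * e2
  have hlt : a' * A + b' * B < 0 := by
    refine lt_of_le_of_ne hnext fun h => ?_
    rw [h] at e1 e2
    simp only [mul_zero, add_zero, sub_zero, mul_eq_zero, hcw.ne, or_false] at e1 e2
    rcases hAB with h | h
    · exact h e1
    · exact h e2
  nlinarith

/-- No vertex lies in the relative interior of an edge. -/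
lemma IsValid.V_ne_edgePoint [NeZero d] {R : STRep d m} (hR : R.IsValid) (i l : Fin d)
    {t : ℝ} (h0 : 0 < t) (h1 : t < R.len i) :
    (fun k => R.V i k + t * (R.dir i k : ℝ)) ≠ R.V l := by
  intro h
  have hk : ∀ k, R.V l k = R.V i k + t * (R.dir i k : ℝ) := fun k => (congrFun h k).symm
  obtain ⟨j, rfl⟩ : ∃ j, l = j + 1 := ⟨l - 1, by simp⟩
  have a1 := hR.edge_halfPlane (j + 1) (R.V_mem_carrier i)
  have a2 := hR.edge_halfPlane (j + 1) (R.V_mem_carrier (i + 1))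
  have b1 := hR.edge_halfPlane j (R.V_mem_carrier i)
  have b2 := hR.edge_halfPlane j (R.V_mem_carrier (i + 1))
  have hcw := hR.clockwise_real j
  have c0 := hR.V_succ j 0
  have c1 := hR.V_succ j 1
  rw [hk] at c0 c1
  rw [hk, hk] at a1 a2
  rw [hR.V_succ, hR.V_succ] at a2 b2
  have hprim := hR.primitive i
  have hne : ¬ ((R.dir i 0 : ℝ) = 0 ∧ (R.dir i 1 : ℝ) = 0) := by
    rintro ⟨h, h'⟩
    have h : R.dir i 0 = 0 := by exact_mod_cast h
    have h' : R.dir i 1 = 0 := by exact_mod_cast h'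
    simp [h, h'] at hprim
  set a := (R.dir i 0 : ℝ)
  set b := (R.dir i 1 : ℝ)
  set p := (R.dir j 0 : ℝ)
  set q := (R.dir j 1 : ℝ)
  set p' := (R.dir (j + 1) 0 : ℝ)
  set q' := (R.dir (j + 1) 1 : ℝ)
  have hs : 0 < R.len i - t := by linarith
  have A : p' * b - q' * a = 0 := by
    have h1 : t * (p' * b - q' * a) ≥ 0 := by linarith
    have h2 : (R.len i - t) * (p' * b - q' * a) ≤ 0 := by linarith
    have h3 := nonneg_of_mul_nonneg_right h1 h0
    have h4 := nonpos_of_mul_nonpos_right h2 hs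
    linarith
  have B : p * b - q * a = 0 := by
    have e0 : R.V j 0 = R.V i 0 + t * a - R.len j * p := by linarith
    have e1 : R.V j 1 = R.V i 1 + t * b - R.len j * q := by linarith
    rw [e0, e1] at b1 b2
    have h1 : t * (p * b - q * a) ≥ 0 := by linarith
    have h2 : (R.len i - t) * (p * b - q * a) ≤ 0 := by linarith
    have h3 := nonneg_of_mul_nonneg_right h1 h0
    have h4 := nonpos_of_mul_nonpos_right h2 hs
    linarith
  apply hne
  constructor
  · have : a * (p * q' - q * p') = 0 := by linear_combination p' * B - p * A
    exact (mul_eq_zero.mp this).resolve_right hcw.ne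
  · have : b * (p * q' - q * p') = 0 := by linear_combination q' * B - q * A
    exact (mul_eq_zero.mp this).resolve_right hcw.ne

end STRep

/-- For a ray starting at abscissa `p` with horizontal speed `r`, the horizontal distance
travelled at time `s` beyond the abscissa `c`, for `c` strictly ahead of `p`. -/
noncomputable def overshoot (p r c s : ℝ) : ℝ :=
  if 0 < (c - p) / r then |r| * max 0 (s - (c - p) / r) else 0

/-- The path issued from `p` in the direction `(d₀, d₁)` that bends at each marked point
ahead of `p`, with slope change prescribed by `u`. -/
noncomputable def bentRay {m : ℕ} (c : Fin m → Pt) (u : Fin m → ℤ) (p : Pt) (d₀ d₁ s : ℝ) :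
    Pt :=
  ![p 0 + s * d₀, p 1 + s * d₁ - ∑ j, (u j : ℝ) * overshoot (p 0) d₀ (c j 0) s]

lemma exists_max_eq_add_overshoot (p r c : ℝ) :
    ∃ i : ℤ, ∀ s, 0 ≤ s →
      max (p + s * r - c) 0 = max (p - c) 0 + s * r * i + overshoot p r c s := by
  unfold overshoot
  rcases lt_trichotomy r 0 with hr | rfl | hr
  · by_cases h : c < p
    · refine ⟨1, fun s hs => ?_⟩
      have h1 : 0 < (c - p) / r := div_pos_of_neg_of_neg (by linarith) hr
      rw [if_pos h1, abs_of_neg hr, max_eq_left (a := p - c) (by linarith),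
        mul_max_of_nonneg _ _ (by linarith)]
      have hne := hr.ne
      have h2 : -r * (s - (c - p) / r) = -(p + s * r - c) := by field_simp; ring
      rw [h2, mul_zero]
      rcases le_total (p + s * r - c) 0 with h3 | h3
      · rw [max_eq_right h3, max_eq_right (by linarith)]; push_cast; ring
      · rw [max_eq_left h3, max_eq_left (by linarith)]; push_cast; ring
    · refine ⟨0, fun s hs => ?_⟩
      have h1 : ¬ 0 < (c - p) / r := not_lt.mpr (div_nonpos_of_nonneg_of_nonpos (by linarith) hr.le)
      have h2 : s * r ≤ 0 := mul_nonpos_of_nonneg_of_nonpos hs hr.le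
      rw [if_neg h1, max_eq_right (by linarith), max_eq_right (by linarith)]; simp
  · exact ⟨0, fun s hs => by simp⟩
  · by_cases h : c ≤ p
    · refine ⟨1, fun s hs => ?_⟩
      have h1 : ¬ 0 < (c - p) / r := not_lt.mpr (div_nonpos_of_nonpos_of_nonneg (by linarith) hr.le)
      have h2 : 0 ≤ s * r := mul_nonneg hs hr.le
      rw [if_neg h1, max_eq_left (by linarith), max_eq_left (by linarith)]; push_cast; ring
    · refine ⟨0, fun s hs => ?_⟩
      push Not at h
      have h1 : 0 < (c - p) / r := div_pos (by linarith) hr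
      rw [if_pos h1, abs_of_pos hr, max_eq_right (a := p - c) (by linarith),
        mul_max_of_nonneg _ _ hr.le]
      have h2 : r * (s - (c - p) / r) = p + s * r - c := by field_simp; ring
      rw [h2, mul_zero, max_comm]; simp

lemma eventually_overshoot_eq_zero (p r c : ℝ) :
    ∀ᶠ s in nhdsWithin (0 : ℝ) (Ioi 0), overshoot p r c s = 0 := by
  unfold overshoot
  split_ifs with h
  · filter_upwards [nhdsWithin_le_nhds (Iio_mem_nhds h)] with s hs
    have hs : s < (c - p) / r := hs
    rw [max_eq_left (by linarith), mul_zero]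
  · exact Filter.Eventually.of_forall fun _ => rfl

lemma stMap_injective {m : ℕ} (c : Fin m → Pt) (n : ℤ) (t : ℝ) (u : Fin m → ℤ) :
    Function.Injective (stMap c n t u) := by
  intro x y h
  have h0 : x 0 = y 0 := by simpa [stMap] using congrFun h 0
  have h1 := congrFun h 1
  simp only [stMap, cons_val_one, cons_val_fin_one, h0] at h1
  ext k
  fin_cases k
  · exact h0
  · exact (by linarith : x 1 = y 1)

lemma continuous_stMap {m : ℕ} (c : Fin m → Pt) (n : ℤ) (t : ℝ) (u : Fin m → ℤ) :
    Continuous (stMap c n t u) := by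
  unfold stMap
  refine continuous_pi fun k => ?_
  fin_cases k
  · simp only [Fin.zero_eta, cons_val_zero]; fun_prop
  · simp only [Fin.mk_one, cons_val_one, cons_val_fin_one]; fun_prop

lemma stMap_bentRay {m : ℕ} (c : Fin m → Pt) (n : ℤ) (t : ℝ) (u : Fin m → ℤ) (p : Pt)
    (d₀ d₁ : ℤ) :
    ∃ k : ℤ, ∀ s : ℝ, 0 ≤ s → stMap c n t u (bentRay c u p d₀ d₁ s) =
      stMap c n t u p + s • ![(d₀ : ℝ), ((d₁ + k * d₀ : ℤ) : ℝ)] := by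
  choose i hi using fun j => exists_max_eq_add_overshoot (p 0) d₀ (c j 0)
  refine ⟨n + ∑ j, u j * i j, fun s hs => ?_⟩
  ext k
  fin_cases k
  · simp [stMap, bentRay]
  · simp only [stMap, bentRay, Fin.mk_one, cons_val_one, cons_val_fin_one, cons_val_zero,
      Pi.add_apply, Pi.smul_apply, smul_eq_mul]
    simp only [hi _ s hs, mul_add, Finset.sum_add_distrib]
    push_cast
    simp only [Finset.sum_mul, mul_add, add_mul, Finset.mul_sum]
    rw [show ∑ j, (u j : ℝ) * (s * d₀ * i j) = ∑ j, s * (u j * i j * d₀) from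
      Finset.sum_congr rfl fun j _ => by ring]
    ring

lemma exists_inverse_coords (M : Matrix.SpecialLinearGroup (Fin 2) ℤ) :
    ∃ A B C E : ℤ, A * E - B * C = 1 ∧
      ∀ x : Pt, sl2Apply M x = ![A * x 0 + B * x 1, C * x 0 + E * x 1] := by
  refine ⟨M.1 0 0, M.1 0 1, M.1 1 0, M.1 1 1, ?_, fun x => ?_⟩
  · have := M.2
    rwa [Matrix.det_fin_two] at this
  · ext k
    fin_cases k <;> simp [sl2Apply, Matrix.mulVec, dotProduct, Fin.sum_univ_two]

/-- A triangle packed at `p` contains the bent ray, of length the size of the triangle,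
issued from `p` along any edge of the polygon at `p`. -/
lemma IsSTPackedTriangleIn.bentRay_mem {m : ℕ} {Δ : Set Pt} {c : Fin m → Pt}
    {eps : Fin m → ℤ} {p : Pt} {lam : ℝ} {B : Set Pt}
    (hB : IsSTPackedTriangleIn Δ c eps p lam B) {dir : Fin 2 → ℤ}
    (hprim : Int.gcd (dir 0) (dir 1) = 1) {δ : ℝ} (hδ : 0 < δ)
    (hedge : ∀ t : ℝ, 0 ≤ t → t ≤ δ →
      (fun k => p k + t * (dir k : ℝ)) ∈ Δ ∧ (fun k => p k + t * (dir k : ℝ)) ∉ interior Δ) :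
    ∃ u : Fin m → ℤ, (∀ j, u j = 0 ∨ u j = eps j) ∧
      ∀ s : ℝ, 0 ≤ s → s < lam → bentRay c u p (dir 0) (dir 1) s ∈ B := by
  obtain ⟨hlam, hBΔ, -, n, t, u, hu, ⟨M, hM⟩, U, hU, hpU, hUeq⟩ := hB
  refine ⟨u, hu, ?_⟩
  obtain ⟨k, hk⟩ := stMap_bentRay c n t u p (dir 0) (dir 1)
  obtain ⟨A, B', C, E, hdet, hMx⟩ := exists_inverse_coords M
  have hdetR : (A : ℝ) * E - B' * C = 1 := by exact_mod_cast hdet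
  set w₁ : ℤ := dir 1 + k * dir 0 with hw₁
  set a : ℤ := E * dir 0 - B' * w₁ with ha
  set b : ℤ := A * w₁ - C * dir 0 with hb
  have haR : (a : ℝ) = E * dir 0 - B' * w₁ := by rw [ha]; push_cast; ring
  have hbR : (b : ℝ) = A * w₁ - C * dir 0 := by rw [hb]; push_cast; ring
  set σ := stMap c n t u with hσ
  -- coordinates of a point of the image with respect to the triangle
  let X : Pt → ℝ := fun z => E * (σ z 0 - σ p 0) - B' * (σ z 1 - σ p 1)
  let Y : Pt → ℝ := fun z => A * (σ z 1 - σ p 1) - C * (σ z 0 - σ p 0)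
  have hmemB : ∀ z, 0 ≤ X z → 0 ≤ Y z → X z + Y z < lam → z ∈ B := by
    intro z h1 h2 h3
    have : σ z ∈ σ '' B := by
      rw [hM]
      refine ⟨![X z, Y z], ⟨by simpa using h1, by simpa using h2, by simpa using h3⟩, ?_⟩
      ext l
      fin_cases l
      · simp only [hMx, X, Y, Fin.zero_eta, Pi.add_apply, cons_val_zero, cons_val_one,
          cons_val_fin_one]
        linear_combination (σ z 0 - σ p 0) * hdetR
      · simp only [hMx, X, Y, Fin.mk_one, Pi.add_apply, cons_val_zero, cons_val_one,
          cons_val_fin_one]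
        linear_combination (σ z 1 - σ p 1) * hdetR
    obtain ⟨z', hz', h⟩ := this
    rwa [← stMap_injective c n t u h]
  have hXY : ∀ s : ℝ, 0 ≤ s → X (bentRay c u p (dir 0) (dir 1) s) = s * a ∧
      Y (bentRay c u p (dir 0) (dir 1) s) = s * b := by
    intro s hs
    constructor
    · simp only [X, hk s hs, Pi.add_apply, Pi.smul_apply, smul_eq_mul, cons_val_zero,
        cons_val_one, cons_val_fin_one, haR]
      ring
    · simp only [Y, hk s hs, Pi.add_apply, Pi.smul_apply, smul_eq_mul, cons_val_zero,
        cons_val_one, cons_val_fin_one, hbR]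
      ring
  -- a point of the edge close to `p`
  obtain ⟨s₀, hs₀, hs₀δ, hzero, hs₀U⟩ : ∃ s₀ : ℝ, 0 < s₀ ∧ s₀ < δ ∧
      (∀ j, overshoot (p 0) (dir 0) (c j 0) s₀ = 0) ∧
      σ (fun l => p l + s₀ * (dir l : ℝ)) ∈ U := by
    have h1 : ∀ᶠ s in nhdsWithin (0 : ℝ) (Ioi 0), 0 < s := self_mem_nhdsWithin
    have h2 : ∀ᶠ s in nhdsWithin (0 : ℝ) (Ioi 0), s < δ :=
      nhdsWithin_le_nhds (Iio_mem_nhds hδ)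
    have h3 : ∀ᶠ s in nhdsWithin (0 : ℝ) (Ioi 0),
        ∀ j, overshoot (p 0) (dir 0) (c j 0) s = 0 :=
      Filter.eventually_all.mpr fun j => eventually_overshoot_eq_zero _ _ _
    have h4 : ∀ᶠ s in nhdsWithin (0 : ℝ) (Ioi 0),
        σ (fun l => p l + s * (dir l : ℝ)) ∈ U := by
      apply nhdsWithin_le_nhds
      have hc : Continuous fun s : ℝ => σ (fun l => p l + s * (dir l : ℝ)) :=
        (continuous_stMap c n t u).comp (by fun_prop)
      apply hc.continuousAt.preimage_mem_nhds
      apply hU.mem_nhds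
      simpa using hpU
    obtain ⟨s, h⟩ := (h1.and (h2.and (h3.and h4))).exists
    exact ⟨s, h.1, h.2.1, h.2.2.1, h.2.2.2⟩
  have hray : bentRay c u p (dir 0) (dir 1) s₀ = fun l => p l + s₀ * (dir l : ℝ) := by
    ext l
    fin_cases l <;> simp [bentRay, hzero]
  obtain ⟨hin, hnint⟩ := hedge s₀ hs₀.le hs₀δ.le
  rw [← hray] at hin hnint hs₀U
  obtain ⟨hX₀, hY₀⟩ := hXY s₀ hs₀.le
  have hcoords : 0 ≤ s₀ * (a : ℝ) ∧ 0 ≤ s₀ * (b : ℝ) ∧ s₀ * (a : ℝ) + s₀ * b < lam := by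
    have hmem : σ (bentRay c u p (dir 0) (dir 1) s₀) ∈ σ '' B :=
      (hUeq.symm.subset ⟨mem_image_of_mem _ hin, hs₀U⟩).1
    rw [hM] at hmem
    obtain ⟨x, ⟨hx0, hx1, hx2⟩, hx⟩ := hmem
    have e0 := congrFun hx 0
    have e1 := congrFun hx 1
    simp only [hMx, Pi.add_apply, cons_val_zero, cons_val_one, cons_val_fin_one] at e0 e1
    have f0 : x 0 = s₀ * a := by
      rw [← hX₀]; simp only [X, ← e0, ← e1]; linear_combination (-x 0) * hdetR
    have f1 : x 1 = s₀ * b := by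
      rw [← hY₀]; simp only [Y, ← e0, ← e1]; linear_combination (-x 1) * hdetR
    rw [← f0, ← f1]
    exact ⟨hx0, hx1, hx2⟩
  have ha0 : 0 ≤ a := by
    exact_mod_cast nonneg_of_mul_nonneg_right hcoords.1 hs₀
  have hb0 : 0 ≤ b := by
    exact_mod_cast nonneg_of_mul_nonneg_right hcoords.2.1 hs₀
  have hXc : Continuous X := by
    have := continuous_stMap c n t u
    fun_prop
  have hYc : Continuous Y := by
    have := continuous_stMap c n t u
    fun_prop
  have hor : a = 0 ∨ b = 0 := by
    by_contra h
    push Not at h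
    have hapos : (0 : ℝ) < a := by exact_mod_cast lt_of_le_of_ne ha0 (Ne.symm h.1)
    have hbpos : (0 : ℝ) < b := by exact_mod_cast lt_of_le_of_ne hb0 (Ne.symm h.2)
    apply hnint
    have hO : IsOpen {z | 0 < X z ∧ 0 < Y z ∧ X z + Y z < lam} :=
      (isOpen_lt continuous_const hXc).inter
        ((isOpen_lt continuous_const hYc).inter (isOpen_lt (hXc.add hYc) continuous_const))
    refine interior_maximal (fun z hz => hBΔ (hmemB z hz.1.le hz.2.1.le hz.2.2)) hO ?_
    simp only [mem_ofPred_eq, hX₀, hY₀]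
    exact ⟨by positivity, by positivity, hcoords.2.2⟩
  have hd0 : dir 0 = A * a + B' * b := by rw [ha, hb]; linear_combination (-dir 0) * hdet
  have hd1 : dir 1 = C * a + E * b - k * (A * a + B' * b) := by
    rw [← hd0, ha, hb]; linear_combination (-w₁) * hdet + hw₁
  have hunit : ∀ e : ℤ, 0 ≤ e → e ∣ dir 0 → e ∣ dir 1 → e = 1 := by
    intro e he h0 h1
    have h2 : e ∣ 1 := by
      have := Int.dvd_coe_gcd h0 h1
      rwa [hprim] at this
    exact Int.eq_one_of_dvd_one he h2
  have hsum : a + b = 1 := by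
    rcases hor with h | h
    · have := hunit b hb0 (by rw [hd0, h]; simp) (by
        rw [hd1, h]; exact ⟨E - k * B', by ring⟩)
      omega
    · have := hunit a ha0 (by rw [hd0, h]; simp) (by
        rw [hd1, h]; exact ⟨C - k * A, by ring⟩)
      omega
  have hsumR : (a : ℝ) + b = 1 := by exact_mod_cast hsum
  intro s hs hslam
  obtain ⟨hX, hY⟩ := hXY s hs
  have ha0R : (0 : ℝ) ≤ a := by exact_mod_cast ha0
  have hb0R : (0 : ℝ) ≤ b := by exact_mod_cast hb0
  apply hmemB
  · rw [hX]; positivity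
  · rw [hY]; positivity
  · rw [hX, hY, ← mul_add, hsumR, mul_one]; exact hslam

/-- A chain of `n` boundary edges of `Δ` that are joined at fake corners, traversed
clockwise (`κ = 1`) or anticlockwise (`κ = -1`). The `k`-th vertex is `v k`, at arc length
`L k` from the start, and the `k`-th edge has direction `(r, y k)`; at most `N k` cuts end
at `v k`, and none ends inside an edge. -/
structure IsBoundaryChain {m : ℕ} (Δ : Set Pt) (c : Fin m → Pt) (eps : Fin m → ℤ)
    (κ r : ℝ) (n : ℕ) (v : ℕ → Pt) (y L : ℕ → ℝ) (N : ℕ → ℕ) : Prop where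
  sign : κ = 1 ∨ κ = -1
  speed_ne_zero : r ≠ 0
  length_zero : L 0 = 0
  length_lt : ∀ k < n, L k < L (k + 1)
  vertex_fst : ∀ k < n, v (k + 1) 0 = v k 0 + (L (k + 1) - L k) * r
  vertex_snd : ∀ k < n, v (k + 1) 1 = v k 1 + (L (k + 1) - L k) * y k
  bend : ∀ k, k + 1 < n → y (k + 1) = y k - κ * N (k + 1) * r
  halfPlane : ∀ k < n, ∀ z ∈ Δ, κ * (r * (z 1 - v k 1) - y k * (z 0 - v k 0)) ≤ 0
  card_le : ∀ k ≤ n,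
    (Finset.univ.filter fun j => 0 < eps j * κ * r ∧ c j 0 = v k 0).card ≤ N k
  cut_free : ∀ k < n, ∀ j, 0 < eps j * κ * r → 0 < (c j 0 - v k 0) / r →
    L (k + 1) - L k ≤ (c j 0 - v k 0) / r

namespace IsBoundaryChain

variable {m : ℕ} {Δ : Set Pt} {c : Fin m → Pt} {eps : Fin m → ℤ} {κ r : ℝ} {n : ℕ}
  {v : ℕ → Pt} {y L : ℕ → ℝ} {N : ℕ → ℕ}

lemma sign_mul_self (h : IsBoundaryChain Δ c eps κ r n v y L N) : κ * κ = 1 := by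
  rcases h.sign with h | h <;> simp [h]

lemma vertex_fst_eq (h : IsBoundaryChain Δ c eps κ r n v y L N) :
    ∀ k ≤ n, v k 0 = v 0 0 + L k * r := by
  intro k
  induction k with
  | zero => simp [h.length_zero]
  | succ k ih =>
    intro hk
    rw [h.vertex_fst k (by omega), ih (by omega)]
    ring

lemma length_nonneg (h : IsBoundaryChain Δ c eps κ r n v y L N) : ∀ k ≤ n, 0 ≤ L k := by
  intro k
  induction k with
  | zero => simp [h.length_zero]
  | succ k ih => exact fun hk => (ih (by omega)).trans (h.length_lt k (by omega)).le

/-- The same chain traversed in the opposite direction. -/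
lemma reverse (h : IsBoundaryChain Δ c eps κ r n v y L N) :
    IsBoundaryChain Δ c eps (-κ) (-r) n (fun k => v (n - k)) (fun k => -y (n - 1 - k))
      (fun k => L n - L (n - k)) (fun k => N (n - k)) := by
  have hidx : ∀ k < n, ∃ l < n, n - k = l + 1 ∧ n - (k + 1) = l ∧ n - 1 - k = l :=
    fun k hk => ⟨n - 1 - k, by omega, by omega, by omega, by omega⟩
  constructor
  · rcases h.sign with h | h <;> simp [h]
  · simpa using h.speed_ne_zero
  · simp
  · intro k hk
    obtain ⟨l, hl, e1, e2, e3⟩ := hidx k hk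
    have := h.length_lt l hl
    simp only [e1, e2]; linarith
  · intro k hk
    obtain ⟨l, hl, e1, e2, e3⟩ := hidx k hk
    simp only [e1, e2, h.vertex_fst l hl]; ring
  · intro k hk
    obtain ⟨l, hl, e1, e2, e3⟩ := hidx k hk
    simp only [e1, e2, e3, h.vertex_snd l hl]; ring
  · intro k hk
    have e1 : n - 1 - k = (n - 1 - (k + 1)) + 1 := by omega
    have e2 : n - (k + 1) = (n - 1 - (k + 1)) + 1 := by omega
    have := h.bend (n - 1 - (k + 1)) (by omega)
    simp only [e1, e2, this]
    ring
  · intro k hk z hz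
    obtain ⟨l, hl, e1, e2, e3⟩ := hidx k hk
    have := h.halfPlane l hl z hz
    simp only [e1, e3, h.vertex_fst l hl, h.vertex_snd l hl]
    linarith
  · intro k hk
    simpa using h.card_le (n - k) (by omega)
  · intro k hk j hj hpos
    obtain ⟨l, hl, e1, e2, e3⟩ := hidx k hk
    simp only [e1, e2] at hpos ⊢
    have hr := h.speed_ne_zero
    have hfst := h.vertex_fst l hl
    have heq : (c j 0 - v (l + 1) 0) / -r = L (l + 1) - L l - (c j 0 - v l 0) / r := by
      rw [hfst]; field_simp; ring
    rw [heq] at hpos ⊢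
    have hlen := h.length_lt l hl
    by_cases h0 : 0 < (c j 0 - v l 0) / r
    · have := h.cut_free l hl j (by simpa using hj) h0
      linarith
    · linarith

/-- The total bending up to arc length `x`, seen at arc length `s`. -/
noncomputable def bending {m : ℕ} (c : Fin m → Pt) (eps : Fin m → ℤ) (κ r p x s : ℝ) : ℝ :=
  ∑ j, if 0 < eps j * κ * r ∧ 0 < (c j 0 - p) / r ∧ (c j 0 - p) / r ≤ x
    then s - (c j 0 - p) / r else 0

lemma bending_succ_le (h : IsBoundaryChain Δ c eps κ r n v y L N) {k : ℕ} (hk : k < n)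
    {s : ℝ} (hs : L (k + 1) ≤ s) :
    bending c eps κ r (v 0 0) (L (k + 1)) s ≤
      bending c eps κ r (v 0 0) (L k) s + N (k + 1) * (s - L (k + 1)) := by
  have hr := h.speed_ne_zero
  have hcard : (∑ j, if 0 < eps j * κ * r ∧ c j 0 = v (k + 1) 0
      then s - L (k + 1) else 0) ≤ N (k + 1) * (s - L (k + 1)) := by
    rw [← Finset.sum_filter, Finset.sum_const, nsmul_eq_mul]
    apply mul_le_mul_of_nonneg_right _ (by linarith)
    exact_mod_cast h.card_le (k + 1) (by omega)
  refine le_trans ?_ (add_le_add_right hcard _)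
  unfold bending
  rw [← Finset.sum_add_distrib]
  refine Finset.sum_le_sum fun j _ => ?_
  set τ := (c j 0 - v 0 0) / r with hτ
  have hnn : 0 ≤ if 0 < eps j * κ * r ∧ c j 0 = v (k + 1) 0 then s - L (k + 1) else 0 := by
    split_ifs <;> linarith
  by_cases h1 : 0 < eps j * κ * r ∧ 0 < τ ∧ τ ≤ L (k + 1)
  · rw [if_pos h1]
    by_cases h2 : τ ≤ L k
    · rw [if_pos ⟨h1.1, h1.2.1, h2⟩]; linarith
    · push Not at h2
      have e : (c j 0 - v k 0) / r = τ - L k := by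
        rw [h.vertex_fst_eq k (by omega), hτ]; field_simp; ring
      have h3 := h.cut_free k hk j h1.1 (by rw [e]; linarith)
      rw [e] at h3
      have h4 : τ = L (k + 1) := by linarith [h1.2.2]
      have h5 : c j 0 = v (k + 1) 0 := by
        rw [h.vertex_fst_eq (k + 1) (by omega), ← h4, hτ]; field_simp; ring
      rw [if_neg (by rintro ⟨-, -, h6⟩; linarith), if_pos ⟨h1.1, h5⟩, h4]
      linarith
  · rw [if_neg h1]
    refine add_nonneg ?_ hnn
    split_ifs with h2
    · linarith [h2.2.2, h.length_lt k hk]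
    · exact le_rfl

lemma edgeLine_le (h : IsBoundaryChain Δ c eps κ r n v y L N) {k : ℕ} (hk : k < n) {s : ℝ}
    (hs : L k ≤ s) :
    κ * r * (v k 1 + y k * (s - L k)) ≤
      κ * r * (v 0 1 + s * y 0) - r ^ 2 * bending c eps κ r (v 0 0) (L k) s := by
  induction k with
  | zero =>
    have : bending c eps κ r (v 0 0) (L 0) s = 0 := by
      unfold bending
      refine Finset.sum_eq_zero fun j _ => if_neg ?_
      rw [h.length_zero]
      rintro ⟨-, h1, h2⟩
      linarith
    rw [this, h.length_zero]
    apply le_of_eq; ring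
  | succ k ih =>
    have h1 := ih (by omega) ((h.length_lt k (by omega)).le.trans hs)
    have h2 := mul_le_mul_of_nonneg_left (h.bending_succ_le (by omega) hs) (sq_nonneg r)
    rw [h.vertex_snd k (by omega), h.bend k hk]
    have h3 := h.sign_mul_self
    have h4 : κ * r * (v k 1 + (L (k + 1) - L k) * y k +
        (y k - κ * N (k + 1) * r) * (s - L (k + 1))) =
        κ * r * (v k 1 + y k * (s - L k)) - r ^ 2 * (N (k + 1) * (s - L (k + 1))) := by
      linear_combination (-(r ^ 2 * (N (k + 1) * (s - L (k + 1))))) * h3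
    rw [h4]
    linarith

lemma le_bentRay (h : IsBoundaryChain Δ c eps κ r n v y L N)
    (heps : ∀ j, eps j = 1 ∨ eps j = -1)
    {u : Fin m → ℤ} (hu : ∀ j, u j = 0 ∨ u j = eps j) (d₁ s : ℝ) :
    κ * r * (v 0 1 + s * d₁) - r ^ 2 * bending c eps κ r (v 0 0) s s ≤
      κ * r * bentRay c u (v 0) r d₁ s 1 := by
  simp only [bentRay, cons_val_one, cons_val_fin_one, mul_sub]
  refine sub_le_sub_left ?_ _
  unfold bending
  rw [Finset.mul_sum, Finset.mul_sum]
  refine Finset.sum_le_sum fun j _ => ?_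
  unfold overshoot
  set τ := (c j 0 - v 0 0) / r with hτ
  by_cases h1 : 0 < τ
  swap
  · rw [if_neg h1, if_neg (by tauto)]; simp
  rw [if_pos h1]
  by_cases h2 : τ ≤ s
  swap
  · rw [if_neg (by tauto), max_eq_left (by linarith)]; simp
  rw [max_eq_right (by linarith)]
  have h3 : 0 ≤ s - τ := by linarith
  have habs : |r| * |r| = r ^ 2 := by rw [abs_mul_abs_self, sq]
  have hr := abs_nonneg r
  by_cases h4 : 0 < eps j * κ * r
  · rw [if_pos ⟨h4, h1, h2⟩]
    have h5 : eps j * κ * r = |r| := by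
      rw [← abs_of_pos h4, abs_mul, abs_mul]
      rcases heps j with e | e <;> rcases h.sign with e' | e' <;> simp [e, e']
    rcases hu j with e | e
    · rw [e]; simp only [Int.cast_zero, zero_mul, mul_zero]; positivity
    · rw [e]
      apply le_of_eq
      rw [← habs]
      linear_combination (|r| * (s - τ)) * h5
  · rw [if_neg (by tauto), mul_zero]
    rcases hu j with e | e
    · rw [e]; simp
    · rw [e]
      push Not at h4
      have := mul_nonpos_of_nonpos_of_nonneg h4 (mul_nonneg hr h3)
      linarith

lemma exists_edge (h : IsBoundaryChain Δ c eps κ r n v y L N) {s : ℝ} (h0 : 0 ≤ s) :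
    ∀ k ≤ n, 0 < k → s ≤ L k → ∃ l < n, L l ≤ s ∧ s ≤ L (l + 1) := by
  intro k
  induction k with
  | zero => simp
  | succ k ih =>
    intro hk _ hs
    by_cases h1 : L k ≤ s
    · exact ⟨k, by omega, h1, hs⟩
    · rcases Nat.eq_zero_or_pos k with rfl | h2
      · exact absurd (h.length_zero.trans_le h0) h1
      · exact ih (by omega) h2 (by linarith)

/-- Along a chain, every bent ray issued from the start stays on or beyond the boundary. -/
lemma snd_le_bentRay (h : IsBoundaryChain Δ c eps κ r n v y L N)
    (heps : ∀ j, eps j = 1 ∨ eps j = -1)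
    {u : Fin m → ℤ} (hu : ∀ j, u j = 0 ∨ u j = eps j) (hn : 0 < n) {s : ℝ} (h0 : 0 ≤ s)
    (hs : s ≤ L n) {z : Pt} (hz : z ∈ Δ) (hz0 : z 0 = v 0 0 + s * r) :
    κ * r * z 1 ≤ κ * r * bentRay c u (v 0) r (y 0) s 1 := by
  obtain ⟨k, hk, h1, h2⟩ := h.exists_edge h0 n le_rfl hn hs
  have hr := h.speed_ne_zero
  have hA : bending c eps κ r (v 0 0) s s ≤ bending c eps κ r (v 0 0) (L k) s := by
    unfold bending
    refine Finset.sum_le_sum fun j _ => ?_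
    set τ := (c j 0 - v 0 0) / r with hτ
    by_cases h3 : 0 < eps j * κ * r ∧ 0 < τ ∧ τ ≤ s
    · rw [if_pos h3]
      by_cases h4 : τ ≤ L k
      · rw [if_pos ⟨h3.1, h3.2.1, h4⟩]
      · push Not at h4
        have e : (c j 0 - v k 0) / r = τ - L k := by
          rw [h.vertex_fst_eq k (by omega), hτ]; field_simp; ring
        have h5 := h.cut_free k hk j h3.1 (by rw [e]; linarith)
        rw [e] at h5
        rw [if_neg (by rintro ⟨-, -, h6⟩; linarith)]
        linarith
    · rw [if_neg h3]
      split_ifs with h4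
      · linarith [h4.2.2]
      · exact le_rfl
  have h3 := h.edgeLine_le hk h1
  have h4 := h.le_bentRay heps hu (y 0) s
  have h5 := mul_le_mul_of_nonneg_left hA (sq_nonneg r)
  have h6 := h.halfPlane k hk z hz
  rw [hz0, h.vertex_fst_eq k (by omega)] at h6
  have h7 : κ * r * z 1 ≤ κ * r * (v k 1 + y k * (s - L k)) := by linarith
  linarith

/-- A bent ray contained in `Δ` cannot be longer than a chain that ends at a true corner. -/
lemma le_length (h : IsBoundaryChain Δ c eps κ r n v y L N)
    (heps : ∀ j, eps j = 1 ∨ eps j = -1)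
    {u : Fin m → ℤ} (hu : ∀ j, u j = 0 ∨ u j = eps j) (hn : 0 < n) {r' y' : ℝ}
    (hnext : ∀ z ∈ Δ, κ * (r' * (z 1 - v n 1) - y' * (z 0 - v n 0)) ≤ 0)
    (hconv : κ * (r * y' - y (n - 1) * r') < 0)
    (hcorner : κ * (r * (y' + κ * N n * r') - y (n - 1) * r') < 0)
    {lam : ℝ} (hlam : ∀ s, 0 ≤ s → s < lam → bentRay c u (v 0) r (y 0) s ∈ Δ) :
    lam ≤ L n := by
  by_contra! hlt
  obtain ⟨k, rfl⟩ : ∃ k, n = k + 1 := ⟨n - 1, by omega⟩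
  simp only [Nat.add_sub_cancel] at hconv hcorner
  have hr := h.speed_ne_zero
  obtain ⟨s, hs, hslam, hsτ⟩ : ∃ s, L (k + 1) < s ∧ s < lam ∧
      ∀ j, (c j 0 - v 0 0) / r ≤ s → (c j 0 - v 0 0) / r ≤ L (k + 1) := by
    have h1 : ∀ᶠ s in nhdsWithin (L (k + 1)) (Ioi (L (k + 1))), L (k + 1) < s :=
      self_mem_nhdsWithin
    have h2 : ∀ᶠ s in nhdsWithin (L (k + 1)) (Ioi (L (k + 1))), s < lam :=
      nhdsWithin_le_nhds (Iio_mem_nhds hlt)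
    have h3 : ∀ᶠ s in nhdsWithin (L (k + 1)) (Ioi (L (k + 1))),
        ∀ j, (c j 0 - v 0 0) / r ≤ s → (c j 0 - v 0 0) / r ≤ L (k + 1) := by
      refine Filter.eventually_all.mpr fun j => ?_
      by_cases h4 : (c j 0 - v 0 0) / r ≤ L (k + 1)
      · exact Filter.Eventually.of_forall fun _ _ => h4
      · push Not at h4
        filter_upwards [nhdsWithin_le_nhds (Iio_mem_nhds h4)] with s hs hs'
        exact absurd hs' (not_le.mpr hs)
    obtain ⟨s, h⟩ := (h1.and (h2.and h3)).exists
    exact ⟨s, h.1, h.2.1, h.2.2⟩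
  have hLn := h.length_nonneg (k + 1) le_rfl
  have hin := hlam s (by linarith) hslam
  have hA : bending c eps κ r (v 0 0) s s ≤ bending c eps κ r (v 0 0) (L (k + 1)) s := by
    unfold bending
    refine Finset.sum_le_sum fun j _ => ?_
    split_ifs with h1 h2 h2
    · exact le_rfl
    · exact absurd ⟨h1.1, h1.2.1, hsτ j h1.2.2⟩ h2
    · exact absurd ⟨h2.1, h2.2.1, h2.2.2.trans hs.le⟩ h1
    · exact le_rfl
  have h1 := h.bending_succ_le (by omega) hs.le
  have h2 := mul_le_mul_of_nonneg_left (hA.trans h1) (sq_nonneg r)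
  have h3 := h.edgeLine_le (k := k) (by omega) ((h.length_lt k (by omega)).le.trans hs.le)
  have h4 := h.le_bentRay heps hu (y 0) s
  have h5 := h.halfPlane k (by omega) _ hin
  have h6 := hnext _ hin
  have hv1 := h.vertex_snd k (by omega)
  have hz0 : bentRay c u (v 0) r (y 0) s 0 = v 0 0 + s * r := by simp [bentRay]
  have hsq := h.sign_mul_self
  set z := bentRay c u (v 0) r (y 0) s
  rw [hz0, h.vertex_fst_eq (k + 1) le_rfl] at h6
  rw [hz0, h.vertex_fst_eq k (by omega)] at h5
  set e := s - L (k + 1) with he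
  have hepos : 0 < e := by linarith
  set W := z 1 - v (k + 1) 1 with hW
  have g1 : κ * (r * W - y k * r * e) ≤ 0 := by
    have : κ * (r * W - y k * r * e) =
        κ * (r * (z 1 - v k 1) - y k * (v 0 0 + s * r - (v 0 0 + L k * r))) := by
      rw [hW, he, hv1]; ring
    linarith
  have g2 : κ * (r' * W - y' * r * e) ≤ 0 := by
    have : κ * (r' * W - y' * r * e) =
        κ * (r' * W - y' * (v 0 0 + s * r - (v 0 0 + L (k + 1) * r))) := by
      rw [he]; ring
    linarith
  have g3 : κ * (r * y k * e) - r ^ 2 * N (k + 1) * e ≤ κ * (r * W) := by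
    have : κ * (r * y k * e) - κ * (r * W) = κ * r * (v k 1 + y k * (s - L k)) - κ * r * z 1 := by
      rw [hW, he, hv1]; ring
    linarith
  have hr2 : 0 < r ^ 2 := by positivity
  rcases lt_or_ge 0 (r * r') with hrr | hrr
  · have a1 := mul_le_mul_of_nonneg_left g3 hrr.le
    have a2 := mul_nonpos_of_nonneg_of_nonpos hr2.le g2
    have a3 := mul_neg_of_pos_of_neg (mul_pos hepos hr2) hcorner
    have a4 : e * r ^ 2 * (κ * (r * (y' + κ * N (k + 1) * r') - y k * r')) =
        r * r' * (r ^ 2 * N (k + 1) * e) +  e * r ^ 2 * (κ * (r * y' - y k * r')) := by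
      linear_combination (e * r ^ 2 * r * N (k + 1) * r') * hsq
    rw [a4] at a3
    linarith
  · have a1 := mul_nonneg_of_nonpos_of_nonpos hrr g1
    have a2 := mul_nonpos_of_nonneg_of_nonpos hr2.le g2
    have a3 := mul_neg_of_pos_of_neg (mul_pos hepos hr2) hconv
    linarith

end IsBoundaryChain

/-- A triangle packed at the start of a chain is no larger than the chain is long, and it
contains the boundary points at arc length less than its size. -/
lemma IsBoundaryChain.packed_size_le {m : ℕ} {Δ : Set Pt} {c : Fin m → Pt} {eps : Fin m → ℤ}
    {κ r : ℝ} {n : ℕ} {v : ℕ → Pt} {y L : ℕ → ℝ} {N : ℕ → ℕ}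
    (h : IsBoundaryChain Δ c eps κ r n v y L N)
    (heps : ∀ j, eps j = 1 ∨ eps j = -1) (hn : 0 < n) {r' y' : ℝ}
    (hnext : ∀ z ∈ Δ, κ * (r' * (z 1 - v n 1) - y' * (z 0 - v n 0)) ≤ 0)
    (hconv : κ * (r * y' - y (n - 1) * r') < 0)
    (hcorner : κ * (r * (y' + κ * N n * r') - y (n - 1) * r') < 0)
    {dir : Fin 2 → ℤ} (hdir0 : (dir 0 : ℝ) = r) (hdir1 : (dir 1 : ℝ) = y 0)
    (hprim : Int.gcd (dir 0) (dir 1) = 1) {δ : ℝ} (hδ : 0 < δ)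
    (hedge : ∀ t : ℝ, 0 ≤ t → t ≤ δ →
      (fun k => v 0 k + t * (dir k : ℝ)) ∈ Δ ∧ (fun k => v 0 k + t * (dir k : ℝ)) ∉ interior Δ)
    {lam : ℝ} {B : Set Pt} (hB : IsSTPackedTriangleIn Δ c eps (v 0) lam B) :
    lam ≤ L n ∧ ∀ s, 0 ≤ s → s < lam → s ≤ L n →
      ∃ q ∈ B, q 0 = v 0 0 + s * r ∧ ∀ z ∈ Δ, z 0 = q 0 → κ * r * z 1 ≤ κ * r * q 1 := by
  obtain ⟨u, hu, hmem⟩ := hB.bentRay_mem hprim hδ hedge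
  rw [hdir0, hdir1] at hmem
  refine ⟨h.le_length heps hu hn hnext hconv hcorner fun s h0 h1 => hB.2.1 (hmem s h0 h1),
    fun s h0 h1 h2 => ⟨_, hmem s h0 h1, by simp [bentRay], fun z hz hz0 => ?_⟩⟩
  exact h.snd_le_bentRay heps hu hn h0 h2 hz (hz0.trans (by simp [bentRay]))

lemma Int.eq_or_eq_neg_of_cross_eq_zero {a₀ a₁ b₀ b₁ : ℤ} (ha : Int.gcd a₀ a₁ = 1)
    (hb : Int.gcd b₀ b₁ = 1) (h : a₀ * b₁ = a₁ * b₀) :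
    (b₀ = a₀ ∧ b₁ = a₁) ∨ (b₀ = -a₀ ∧ b₁ = -a₁) := by
  obtain ⟨x, y, hxy⟩ := Int.isCoprime_iff_gcd_eq_one.mpr ha
  set t := b₀ * x + b₁ * y with ht
  have h0 : b₀ = t * a₀ := by rw [ht]; linear_combination (-b₀) * hxy + (-y) * h
  have h1 : b₁ = t * a₁ := by rw [ht]; linear_combination (-b₁) * hxy + x * h
  have hu : t ∣ 1 := by
    have := Int.dvd_coe_gcd (Dvd.intro _ h0.symm) (Dvd.intro _ h1.symm)
    rwa [hb] at this
  rcases Int.isUnit_iff.mp (isUnit_of_dvd_one hu) with e | e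
  · left; rw [h0, h1, e]; simp
  · right; rw [h0, h1, e]; simp

/-- The vertex index reached from `i` after `k` steps around the cycle. -/
def cycShift {d : ℕ} [NeZero d] (i : Fin d) (k : ℕ) : Fin d := i + Fin.ofNat d k

lemma cycShift_zero {d : ℕ} [NeZero d] (i : Fin d) : cycShift i 0 = i := by
  simp [cycShift]

lemma cycShift_val {d : ℕ} [NeZero d] (i : Fin d) (k : ℕ) :
    (cycShift i k).val = (i.val + k) % d := by
  simp [cycShift, Fin.val_add]

lemma cycShift_succ {d : ℕ} [NeZero d] (i : Fin d) (k : ℕ) :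
    cycShift i (k + 1) = cycShift i k + 1 := by
  apply Fin.ext
  simp [cycShift_val, Fin.val_add, add_assoc]

namespace STRep

variable {d m : ℕ}

lemma IsValid.halfPlane_head [NeZero d] {R : STRep d m} (hR : R.IsValid) (i : Fin d)
    {z : Pt} (hz : z ∈ R.carrier) :
    (R.dir i 0 : ℝ) * (z 1 - R.V (i + 1) 1) - R.dir i 1 * (z 0 - R.V (i + 1) 0) ≤ 0 := by
  have := hR.edge_halfPlane i hz
  rw [hR.V_succ, hR.V_succ]
  linarith

lemma detZ_corner [NeZero d] (R : STRep d m) (i : Fin d) (N : ℤ) :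
    detZ (R.u1 (i + 1)) ((Tpow N).mulVec (R.u2 (i + 1))) =
      -(R.dir i 0 * (R.dir (i + 1) 1 + N * R.dir (i + 1) 0) - R.dir i 1 * R.dir (i + 1) 0) := by
  simp [detZ, u1, u2, Tpow, Matrix.mulVec, dotProduct, Fin.sum_univ_two]
  ring

/-- At a fake corner, the outgoing direction is the sheared incoming one. -/
lemma IsValid.dir_of_isFakeCorner [NeZero d] {R : STRep d m} (hR : R.IsValid) {i : Fin d}
    (h : R.IsFakeCorner (i + 1)) :
    R.dir (i + 1) 0 = R.dir i 0 ∧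
      R.dir (i + 1) 1 = R.dir i 1 - R.numCuts (i + 1) * R.dir i 0 ∧ R.dir i 0 ≠ 0 := by
  obtain ⟨-, hdet⟩ := h
  rw [detZ_corner] at hdet
  set N : ℤ := (R.numCuts (i + 1) : ℤ) with hN
  have hN0 : 0 ≤ N := by omega
  have hcw := hR.clockwise i
  unfold detZ at hcw
  have hp : Int.gcd (R.dir (i + 1) 0) (R.dir (i + 1) 1 + N * R.dir (i + 1) 0) = 1 := by
    simpa using hR.primitive (i + 1)
  have hcases := Int.eq_or_eq_neg_of_cross_eq_zero (hR.primitive i) hp (by linarith)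
  set a₀ := R.dir i 0
  set a₁ := R.dir i 1
  have hsq := mul_nonneg hN0 (mul_self_nonneg a₀)
  rcases hcases with ⟨h0, h1⟩ | ⟨h0, h1⟩
  · refine ⟨h0, by rw [h0] at h1; linarith, fun h => ?_⟩
    rw [h0, h] at hcw
    simp at hcw
  · exfalso
    have h1' : R.dir (i + 1) 1 = -a₁ + N * a₀ := by rw [h0] at h1; linarith
    rw [h0, h1'] at hcw
    linarith

lemma IsValid.corner_neg [NeZero d] {R : STRep d m} (hR : R.IsValid) {i : Fin d}
    (h : ¬ R.IsFakeCorner (i + 1)) :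
    (R.dir i 0 : ℝ) * (R.dir (i + 1) 1 + R.numCuts (i + 1) * R.dir (i + 1) 0)
      - R.dir i 1 * R.dir (i + 1) 0 < 0 := by
  rcases Nat.eq_zero_or_pos (R.numCuts (i + 1)) with h0 | hpos
  · rw [h0]
    simpa using hR.clockwise_real i
  · have h1 : detZ (R.u1 (i + 1))
        ((Tpow (R.numCuts (i + 1) : ℤ)).mulVec (R.u2 (i + 1))) = 1 :=
      (hR.corner_cut _ hpos).resolve_left fun h2 => h ⟨hpos, h2⟩
    rw [detZ_corner] at h1
    have h2 : R.dir i 0 * (R.dir (i + 1) 1 + (R.numCuts (i + 1) : ℤ) * R.dir (i + 1) 0)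
        - R.dir i 1 * R.dir (i + 1) 0 < 0 := by linarith
    exact_mod_cast h2

lemma cutHits_of_halfPlane {R : STRep d m} {j : Fin m} {q : Pt}
    (hq : q ∈ frontier R.carrier) {r y : ℝ} (hr : 0 < R.eps j * r) (h0 : R.c j 0 = q 0)
    (hle : r * (R.c j 1 - q 1) - y * (R.c j 0 - q 0) ≤ 0) : R.CutHits j q := by
  refine ⟨hq, h0.symm, ?_⟩
  rw [h0, sub_self, mul_zero, sub_zero] at hle
  have hr0 : r ≠ 0 := by rintro rfl; simp at hr
  have h1 := mul_nonpos_of_nonneg_of_nonpos hr.le hle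
  have h2 : 0 ≤ r ^ 2 * (R.eps j * (q 1 - R.c j 1)) := by linarith
  exact nonneg_of_mul_nonneg_right h2 (by positivity)

lemma IsValid.V_mem_frontier [NeZero d] {R : STRep d m} (hR : R.IsValid) (i : Fin d) :
    R.V i ∈ frontier R.carrier := by
  simpa using hR.edgePoint_mem_frontier i le_rfl (hR.len_pos i).le

section Chain

variable [NeZero d] {R : STRep d m} {i₀ : Fin d} {n : ℕ}

lemma IsValid.dir_fst_eq (hR : R.IsValid)
    (hfake : ∀ k : ℕ, 0 < k → k < n → R.IsFakeCorner (cycShift i₀ k)) :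
    ∀ k : ℕ, k < n → R.dir (cycShift i₀ k) 0 = R.dir i₀ 0 := by
  intro k
  induction k with
  | zero => simp [cycShift_zero]
  | succ k ih =>
    intro hk
    have h := hfake (k + 1) (by omega) hk
    rw [cycShift_succ] at h ⊢
    rw [(hR.dir_of_isFakeCorner h).1, ih (by omega)]

lemma IsValid.isBoundaryChain (hR : R.IsValid)
    (hfake : ∀ k : ℕ, 0 < k → k < n → R.IsFakeCorner (cycShift i₀ k))
    (hn : 0 < n) (hr : R.dir i₀ 0 ≠ 0) :
    IsBoundaryChain R.carrier R.c R.eps 1 (R.dir i₀ 0) n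
      (fun k => R.V (cycShift i₀ k)) (fun k => R.dir (cycShift i₀ k) 1)
      (fun k => ∑ l ∈ Finset.range k, R.len (cycShift i₀ l))
      (fun k => R.numCuts (cycShift i₀ k)) := by
  have hdir := hR.dir_fst_eq hfake
  have hrR : (R.dir i₀ 0 : ℝ) ≠ 0 := by exact_mod_cast hr
  constructor
  · exact Or.inl rfl
  · exact hrR
  · simp
  · intro k _
    simp [Finset.sum_range_succ, hR.len_pos]
  · intro k hk
    simp [Finset.sum_range_succ, cycShift_succ, hR.V_succ, hdir k hk]
  · intro k hk
    simp [Finset.sum_range_succ, cycShift_succ, hR.V_succ]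
  · intro k hk
    have h := hfake (k + 1) (by omega) hk
    simp only [cycShift_succ] at h ⊢
    rw [(hR.dir_of_isFakeCorner h).2.1, hdir k (by omega)]
    push_cast; ring
  · intro k hk z hz
    have := hR.edge_halfPlane (cycShift i₀ k) hz
    rw [hdir k hk] at this
    simpa using this
  · intro k hk
    unfold numCuts
    rw [← Set.ncard_coe_finset]
    refine Set.ncard_le_ncard ?_ (Set.toFinite _)
    intro j hj
    simp only [Finset.coe_filter, Finset.mem_univ, true_and, mem_ofPred_eq, mul_one] at hj ⊢
    obtain ⟨hj1, hj2⟩ := hj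
    have hc := interior_subset (hR.marked_interior j)
    refine cutHits_of_halfPlane (hR.V_mem_frontier _) hj1 hj2 (y := if k < n then
      R.dir (cycShift i₀ k) 1 else R.dir (cycShift i₀ (n - 1)) 1) ?_
    split_ifs with hkn
    · rw [← hdir k hkn]
      exact hR.edge_halfPlane _ hc
    · obtain rfl : k = (n - 1) + 1 := by omega
      rw [cycShift_succ, ← hdir (n - 1) (by omega)]
      exact hR.halfPlane_head _ hc
  · intro k hk j hj hpos
    by_contra! hlt
    simp only [Finset.sum_range_succ, add_sub_cancel_left, mul_one] at hlt hj
    set i := cycShift i₀ k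
    set τ := (R.c j 0 - R.V i 0) / (R.dir i₀ 0 : ℝ) with hτ
    have hc := interior_subset (hR.marked_interior j)
    have hi : R.dir i 0 = R.dir i₀ 0 := hdir k hk
    have hq0 : R.c j 0 = R.V i 0 + τ * (R.dir i 0 : ℝ) := by
      rw [hi, hτ]; field_simp; ring
    have hhits : R.CutHits j (fun l => R.V i l + τ * (R.dir i l : ℝ)) := by
      refine cutHits_of_halfPlane (hR.edgePoint_mem_frontier i hpos.le hlt.le) hj hq0
        (y := R.dir i 1) ?_
      have := hR.edge_halfPlane i hc
      rw [← hi]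
      linarith
    obtain ⟨l, hl⟩ := hR.cuts_at_vertices j _ hhits
    exact hR.V_ne_edgePoint i l hpos hlt hl

lemma IsValid.edgePoint_mem_and_notMem (hR : R.IsValid) (i : Fin d) {t : ℝ} (h0 : 0 ≤ t)
    (h1 : t ≤ R.len i) :
    (fun k => R.V i k + t * (R.dir i k : ℝ)) ∈ R.carrier ∧
      (fun k => R.V i k + t * (R.dir i k : ℝ)) ∉ interior R.carrier := by
  have h := hR.edgePoint_mem_frontier i h0 h1
  exact ⟨R.isClosed_carrier.frontier_subset h, h.2⟩

lemma IsValid.edgePoint_mem_and_notMem_neg (hR : R.IsValid) (i : Fin d) {t : ℝ} (h0 : 0 ≤ t)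
    (h1 : t ≤ R.len i) :
    (fun k => R.V (i + 1) k + t * ((-R.dir i k : ℤ) : ℝ)) ∈ R.carrier ∧
      (fun k => R.V (i + 1) k + t * ((-R.dir i k : ℤ) : ℝ)) ∉ interior R.carrier := by
  have h := hR.edgePoint_mem_and_notMem i (t := R.len i - t) (by linarith) (by linarith)
  have e : (fun k => R.V (i + 1) k + t * ((-R.dir i k : ℤ) : ℝ)) =
      fun k => R.V i k + (R.len i - t) * (R.dir i k : ℝ) := by
    ext k
    rw [hR.V_succ]; push_cast; ring
  rwa [e]

end Chain

end STRep

lemma add_le_of_no_common_point {a b l : ℝ} (hl : 0 ≤ l) (ha : a = 0 ∨ a ≤ l)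
    (hb : b = 0 ∨ b ≤ l)
    (h : ∀ s t, 0 ≤ s → s < a → 0 ≤ t → t < b → s + t = l → False) : a + b ≤ l := by
  have ha' : a ≤ l := ha.elim (fun h => h ▸ hl) id
  have hb' : b ≤ l := hb.elim (fun h => h ▸ hl) id
  by_contra! hlt
  exact h ((a + (l - b)) / 2) ((b + (l - a)) / 2) (by linarith) (by linarith) (by linarith)
    (by linarith) (by ring)

lemma distCyc_eq_ite {d : ℕ} (s i : Fin d) :
    distCyc s i = if s.val ≤ i.val then i.val - s.val else i.val + d - s.val := by
  have hs := s.isLt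
  have hi := i.isLt
  unfold distCyc
  split_ifs with h
  · rw [show i.val + d - s.val = (i.val - s.val) + d by omega, Nat.add_mod_right,
      Nat.mod_eq_of_lt (by omega)]
  · exact Nat.mod_eq_of_lt (by omega)

lemma cycShift_val_eq_ite {d : ℕ} [NeZero d] (s : Fin d) {k : ℕ} (hk : k ≤ d) :
    (cycShift s k).val = if s.val + k < d then s.val + k else s.val + k - d := by
  have hs := s.isLt
  rw [cycShift_val]
  split_ifs with h
  · exact Nat.mod_eq_of_lt h
  · rw [Nat.mod_eq_sub_mod (by omega), Nat.mod_eq_of_lt (by omega)]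

lemma distCyc_cycShift {d : ℕ} [NeZero d] (s : Fin d) {k : ℕ} (hk : k < d) :
    distCyc s (cycShift s k) = k := by
  have hs := s.isLt
  rw [distCyc_eq_ite, cycShift_val_eq_ite s hk.le]
  split_ifs <;> omega

lemma distCyc_lt {d : ℕ} (s i : Fin d) : distCyc s i < d := Nat.mod_lt _ s.pos

lemma cycShift_distCyc {d : ℕ} [NeZero d] (s i : Fin d) : cycShift s (distCyc s i) = i := by
  have hs := s.isLt
  have hi := i.isLt
  apply Fin.ext
  rw [cycShift_val_eq_ite s (distCyc_lt s i).le, distCyc_eq_ite]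
  split_ifs <;> omega

lemma chainLen_pos {d : ℕ} (s e : Fin d) : 0 < chainLen s e := by
  have hs := s.isLt
  have he := e.isLt
  unfold chainLen
  simp only [distCyc_eq_ite, Fin.ext_iff]
  split_ifs <;> omega

lemma chainLen_le {d : ℕ} (s e : Fin d) : chainLen s e ≤ d := by
  unfold chainLen
  split_ifs
  · exact le_rfl
  · exact (distCyc_lt s e).le

lemma cycShift_chainLen {d : ℕ} [NeZero d] (s e : Fin d) : cycShift s (chainLen s e) = e := by
  unfold chainLen
  split_ifs with h
  · apply Fin.ext
    rw [cycShift_val, Nat.add_mod_right, Nat.mod_eq_of_lt s.isLt, h]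
  · exact cycShift_distCyc s e

/-- No enumerated index lies strictly between two cyclically consecutive ones. -/
lemma cycShift_ne_of_lt_chainLen {d D : ℕ} [NeZero d] [NeZero D] {g : Fin D → Fin d}
    (hg : StrictMono g) (a b : Fin D) {k : ℕ} (h0 : 0 < k)
    (hk : k < chainLen (g a) (g (a + 1))) : g b ≠ cycShift (g a) k := by
  intro hb
  have hkd : k < d := hk.trans_le (chainLen_le _ _)
  have hdist := distCyc_cycShift (g a) hkd
  rw [← hb, distCyc_eq_ite] at hdist
  unfold chainLen at hk
  rw [distCyc_eq_ite] at hk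
  simp only [Fin.ext_iff] at hdist hk
  have ha := (g a).isLt
  have hb := (g b).isLt
  have ha' := (g (a + 1)).isLt
  have hle : ∀ x y : Fin D, x.val ≤ y.val → (g x).val ≤ (g y).val := fun x y h => hg.monotone h
  have hlt : ∀ x y : Fin D, x.val < y.val → (g x).val < (g y).val := fun x y h => hg h
  rcases Nat.lt_or_ge (a.val + 1) D with h | h
  · have hv : (a + 1).val = a.val + 1 := Fin.val_add_one_of_lt' h
    have h1 := hlt a (a + 1) (by omega)
    rcases Nat.lt_or_ge a.val b.val with h2 | h2
    · have := hle (a + 1) b (by omega)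
      split_ifs at hdist hk <;> omega
    · have := hle b a h2
      split_ifs at hdist hk <;> omega
  · have hv : (a + 1).val = 0 := by
      have := a.isLt
      rw [Fin.val_add, Fin.val_one', Nat.add_mod_mod, show a.val + 1 = D by omega, Nat.mod_self]
    have h1 := hle (a + 1) b (by omega)
    have h2 := hle b a (by omega)
    split_ifs at hdist hk <;> omega

lemma stEdgeLen_eq_sum_range {d m D : ℕ} [NeZero d] [NeZero D] (R : STRep d m)
    (g : Fin D → Fin d) (a : Fin D) :
    stEdgeLen R g a =
      ∑ k ∈ Finset.range (chainLen (g a) (g (a + 1))), R.len (cycShift (g a) k) := by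
  unfold stEdgeLen
  rw [← Finset.sum_filter]
  refine (Finset.sum_nbij' (cycShift (g a)) (distCyc (g a)) ?_ ?_ ?_ ?_ ?_).symm
  · intro k hk
    rw [Finset.mem_range] at hk
    rw [Finset.mem_filter, distCyc_cycShift _ (hk.trans_le (chainLen_le _ _))]
    exact ⟨Finset.mem_univ _, hk⟩
  · intro i hi
    exact Finset.mem_range.mpr (Finset.mem_filter.mp hi).2
  · intro k hk
    exact distCyc_cycShift _ ((Finset.mem_range.mp hk).trans_le (chainLen_le _ _))
  · intro i _
    exact cycShift_distCyc _ _
  · intro k _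
    rfl

/-- Two points of a set over the same abscissa that are both extremal in the same
vertical direction coincide. -/
lemma eq_of_extremal {Δ : Set Pt} {ρ : ℝ} (hρ : ρ ≠ 0) {q q' : Pt} (hq : q ∈ Δ) (hq' : q' ∈ Δ)
    (h0 : q 0 = q' 0) (h : ∀ z ∈ Δ, z 0 = q 0 → ρ * z 1 ≤ ρ * q 1)
    (h' : ∀ z ∈ Δ, z 0 = q' 0 → ρ * z 1 ≤ ρ * q' 1) : q = q' := by
  ext k
  fin_cases k
  · exact h0
  · exact mul_left_cancel₀ hρ (le_antisymm (h' q hq h0) (h q' hq' h0.symm))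

namespace STRep

/-- A triangle packed at a vertex contains the part of a vertical edge at that vertex shorter
than its size. -/
lemma packed_vertical_mem {d m : ℕ} {R : STRep d m} {p : Pt} {lam : ℝ} {B : Set Pt}
    (hB : IsSTPackedTriangle R p lam B) {dir : Fin 2 → ℤ} (hv : dir 0 = 0)
    (hprim : Int.gcd (dir 0) (dir 1) = 1) {δ : ℝ} (hδ : 0 < δ)
    (hedge : ∀ t : ℝ, 0 ≤ t → t ≤ δ → (fun k => p k + t * (dir k : ℝ)) ∈ R.carrier ∧
      (fun k => p k + t * (dir k : ℝ)) ∉ interior R.carrier) {s : ℝ} (h0 : 0 ≤ s)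
    (h1 : s < lam) : (![p 0, p 1 + s * dir 1] : Pt) ∈ B := by
  obtain ⟨u, -, hmem⟩ := IsSTPackedTriangleIn.bentRay_mem hB hprim hδ hedge
  simpa [bentRay, overshoot, hv] using hmem s h0 h1

variable {d m : ℕ} [NeZero d] {R : STRep d m}

/-- Triangles packed at the two ends of a semitoric edge, non-vertical case. -/
lemma IsValid.add_le_chain (hR : R.IsValid) {i₀ : Fin d} {n : ℕ} (hn : 0 < n)
    (hr : R.dir i₀ 0 ≠ 0)
    (hfake : ∀ k : ℕ, 0 < k → k < n → R.IsFakeCorner (cycShift i₀ k))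
    (h0 : ¬ R.IsFakeCorner i₀) (h1 : ¬ R.IsFakeCorner (cycShift i₀ n))
    {a b : ℝ} {A B : Set Pt}
    (hA : a = 0 ∨ IsSTPackedTriangle R (R.V i₀) a A)
    (hB : b = 0 ∨ IsSTPackedTriangle R (R.V (cycShift i₀ n)) b B)
    (hAB : R.V i₀ ≠ R.V (cycShift i₀ n) → Disjoint A B) :
    a + b ≤ ∑ k ∈ Finset.range n, R.len (cycShift i₀ k) := by
  obtain ⟨N, rfl⟩ : ∃ N, n = N + 1 := ⟨n - 1, by omega⟩
  have hrR : (R.dir i₀ 0 : ℝ) ≠ 0 := by exact_mod_cast hr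
  have hch := hR.isBoundaryChain hfake hn hr
  have hrev := hch.reverse
  have hlast : (R.dir (cycShift i₀ N) 0 : ℝ) = R.dir i₀ 0 := by
    rw [hR.dir_fst_eq hfake N (by omega)]
  obtain ⟨p, hp⟩ : ∃ p, p + 1 = i₀ := ⟨i₀ - 1, sub_add_cancel _ _⟩
  have fwd : IsSTPackedTriangle R (R.V i₀) a A → _ := fun hA =>
    hch.packed_size_le (B := A) (lam := a) hR.eps_pm hn
      (r' := R.dir (cycShift i₀ N + 1) 0) (y' := R.dir (cycShift i₀ N + 1) 1)
      (fun z hz => by simpa [cycShift_succ] using hR.edge_halfPlane (cycShift i₀ N + 1) hz)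
      (by simpa [← hlast] using hR.clockwise_real (cycShift i₀ N))
      (by
        have := hR.corner_neg (i := cycShift i₀ N) (by rwa [← cycShift_succ])
        simpa [← hlast, cycShift_succ] using this)
      (dir := R.dir i₀) rfl (by simp [cycShift_zero]) (hR.primitive i₀) (hR.len_pos i₀)
      (fun t ht0 ht1 => by
        simpa [cycShift_zero] using hR.edgePoint_mem_and_notMem i₀ ht0 ht1)
      (by simpa [cycShift_zero, IsSTPackedTriangle] using hA)
  have bwd : IsSTPackedTriangle R (R.V (cycShift i₀ (N + 1))) b B → _ := fun hB =>
    hrev.packed_size_le (B := B) (lam := b) hR.eps_pm hn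
      (r' := -R.dir p 0) (y' := -R.dir p 1)
      (fun z hz => by
        have := hR.halfPlane_head p hz
        rw [hp] at this
        simp only [Nat.sub_self, cycShift_zero]
        linarith)
      (by
        have := hR.clockwise_real p
        rw [hp] at this
        simp only [Nat.add_sub_cancel, Nat.sub_self, cycShift_zero]
        linarith)
      (by
        have := hR.corner_neg (i := p) (by rwa [hp])
        rw [hp] at this
        simp only [Nat.add_sub_cancel, Nat.sub_self, cycShift_zero]
        linarith)
      (dir := fun k => -R.dir (cycShift i₀ N) k) (by simp [hlast]) (by simp)
      (by simpa using hR.primitive (cycShift i₀ N)) (hR.len_pos (cycShift i₀ N))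
      (fun t ht0 ht1 => by
        simpa [cycShift_succ] using hR.edgePoint_mem_and_notMem_neg (cycShift i₀ N) ht0 ht1)
      (by simpa [IsSTPackedTriangle] using hB)
  set l := ∑ k ∈ Finset.range (N + 1), R.len (cycShift i₀ k) with hl
  have hlpos : 0 < l := Finset.sum_pos (fun k _ => hR.len_pos _) (by simp)
  have hVn : R.V (cycShift i₀ (N + 1)) 0 = R.V i₀ 0 + l * R.dir i₀ 0 := by
    simpa [cycShift_zero] using hch.vertex_fst_eq (N + 1) le_rfl
  have hne : R.V i₀ ≠ R.V (cycShift i₀ (N + 1)) := by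
    intro h
    rw [← h] at hVn
    have : l * (R.dir i₀ 0 : ℝ) ≠ 0 := mul_ne_zero hlpos.ne' hrR
    apply this
    linarith
  refine add_le_of_no_common_point hlpos.le (hA.imp id fun h => (fwd h).1)
    (hB.imp id fun h => by simpa using (bwd h).1) fun s t hs hsa ht htb hst => ?_
  have hA := hA.resolve_left (by rintro rfl; linarith)
  have hB := hB.resolve_left (by rintro rfl; linarith)
  obtain ⟨q, hqA, hq0, hq1⟩ := (fwd hA).2 s hs hsa (by linarith)
  obtain ⟨q', hqB, hq0', hq1'⟩ := (bwd hB).2 t ht htb (by simp; linarith)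
  simp only [Nat.sub_zero, cycShift_zero] at hq0 hq0'
  have h00 : q 0 = q' 0 := by
    rw [hq0, hq0', hVn, ← hst]; ring
  have hqq : q = q' := eq_of_extremal hrR (hA.2.1 hqA) (hB.2.1 hqB) h00
    (by simpa using hq1) (by simpa using hq1')
  exact Set.disjoint_left.mp (hAB hne) hqA (hqq ▸ hqB)

/-- Triangles packed at the two ends of a vertical edge. -/
lemma IsValid.add_le_vertical (hR : R.IsValid) {i : Fin d} (hv : R.dir i 0 = 0)
    {a b : ℝ} {A B : Set Pt}
    (hA : a = 0 ∨ IsSTPackedTriangle R (R.V i) a A)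
    (hB : b = 0 ∨ IsSTPackedTriangle R (R.V (i + 1)) b B)
    (hAB : R.V i ≠ R.V (i + 1) → Disjoint A B) : a + b ≤ R.len i := by
  have hlen := hR.len_pos i
  obtain ⟨p, hp⟩ : ∃ p, p + 1 = i := ⟨i - 1, sub_add_cancel _ _⟩
  have hvR : (R.dir i 0 : ℝ) = 0 := by exact_mod_cast hv
  have e0 := hR.V_succ i 0
  have e1 := hR.V_succ i 1
  rw [hvR, mul_zero, add_zero] at e0
  have hcw := hR.clockwise_real i
  have hcwp := hR.clockwise_real p
  rw [hp, hvR] at hcwp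
  rw [hvR] at hcw
  have hne : R.V i ≠ R.V (i + 1) := by
    intro h
    rw [← h] at e1
    have h2 : R.len i * (R.dir i 1 : ℝ) = 0 := by linarith
    rcases mul_eq_zero.mp h2 with h3 | h3
    · exact hlen.ne' h3
    · simp [h3] at hcw
  have memA : IsSTPackedTriangle R (R.V i) a A → ∀ s, 0 ≤ s → s < a →
      (![R.V i 0, R.V i 1 + s * R.dir i 1] : Pt) ∈ A := fun hA s h0 h1 =>
    packed_vertical_mem hA hv (hR.primitive i) hlen
      (fun t => hR.edgePoint_mem_and_notMem i) h0 h1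
  have memB : IsSTPackedTriangle R (R.V (i + 1)) b B → ∀ t, 0 ≤ t → t < b →
      (![R.V i 0, R.V i 1 + (R.len i - t) * R.dir i 1] : Pt) ∈ B := fun hB t h0 h1 => by
    have h := packed_vertical_mem hB (dir := fun k => -R.dir i k) (by simp [hv])
      (by simpa using hR.primitive i) hlen
      (fun t => hR.edgePoint_mem_and_notMem_neg i) h0 h1
    have e : R.V i 1 + (R.len i - t) * R.dir i 1 =
        R.V (i + 1) 1 + t * ((-R.dir i 1 : ℤ) : ℝ) := by
      rw [e1]; push_cast; ring
    rw [← e0, e]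
    exact h
  refine add_le_of_no_common_point hlen.le (hA.imp id fun h => ?_) (hB.imp id fun h => ?_)
    fun s t hs hsa ht htb hst => ?_
  · by_contra! hlt
    have hz := hR.edge_halfPlane (i + 1)
      (h.2.1 (memA h ((R.len i + a) / 2) (by linarith) (by linarith)))
    simp only [Matrix.cons_val_zero, Matrix.cons_val_one, e0, e1, sub_self, mul_zero,
      sub_zero] at hz
    have h3 : 0 < (R.dir i 1 * R.dir (i + 1) 0 : ℝ) * ((a - R.len i) / 2) :=
      mul_pos (by linarith) (by linarith)
    linarith
  · by_contra! hlt
    have hz := hR.halfPlane_head p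
      (h.2.1 (memB h ((R.len i + b) / 2) (by linarith) (by linarith)))
    rw [hp] at hz
    simp only [Matrix.cons_val_zero, Matrix.cons_val_one, sub_self, mul_zero, sub_zero] at hz
    have h3 : 0 < (-(R.dir p 0 * R.dir i 1) : ℝ) * ((b - R.len i) / 2) :=
      mul_pos (by linarith) (by linarith)
    linarith
  · have hA := hA.resolve_left (by rintro rfl; linarith)
    have hB := hB.resolve_left (by rintro rfl; linarith)
    have hs' := memA hA s hs hsa
    have ht' := memB hB t ht htb
    rw [← hst, add_sub_cancel_right] at ht'
    exact Set.disjoint_left.mp (hAB hne) hs' ht'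

end STRep

/-- If `P = ∪ B_a` is a semitoric packing of the representative `R`
with `B_a` packed at the hidden/Delzant corner `p_a = V (g a)` and `λ_a` the
`SL₂(ℤ)`-size of `B_a` (`λ_a = 0` if `B_a` is empty), then `λ_a + λ_{a+1} ≤ ℓ_a`,
where `ℓ_a` is the `SL₂(ℤ)`-length of the semitoric edge from `p_a` to `p_{a+1}`. -/
theorem stmt11 {d m D : ℕ} [NeZero d] [NeZero D] (R : STRep d m) (hR : R.IsValid)
    (g : Fin D → Fin d) (hg : IsCornerEnum R g)
    (sz : Fin D → ℝ) (P : Set Pt) (hP : IsSTPacking R g sz P) :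
    ∀ a : Fin D, sz a + sz (a + 1) ≤ stEdgeLen R g a := by
  obtain ⟨tri, -, htri, hdisj⟩ := hP
  intro a
  rw [stEdgeLen_eq_sum_range]
  have hend := cycShift_chainLen (g a) (g (a + 1))
  have hpos := chainLen_pos (g a) (g (a + 1))
  have hfake : ∀ k : ℕ, 0 < k → k < chainLen (g a) (g (a + 1)) →
      R.IsFakeCorner (cycShift (g a) k) := by
    intro k h0 hk
    by_contra h
    obtain ⟨b, hb⟩ := (hg.2 _).mp h
    exact cycShift_ne_of_lt_chainLen hg.1 a b h0 hk hb
  have hA := (htri a).imp_left And.left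
  have hB := (htri (a + 1)).imp_left And.left
  have hAB : R.V (g a) ≠ R.V (g (a + 1)) → Disjoint (tri a) (tri (a + 1)) := fun h =>
    hdisj fun h' => h (congrArg (fun b => R.V (g b)) h')
  by_cases hv : R.dir (g a) 0 = 0
  · have hn : chainLen (g a) (g (a + 1)) = 1 := by
      by_contra hne
      have h := hfake 1 one_pos (by omega)
      rw [cycShift_succ, cycShift_zero] at h
      exact (hR.dir_of_isFakeCorner h).2.2 hv
    rw [hn, cycShift_succ, cycShift_zero] at hend
    rw [hn, Finset.sum_range_one, cycShift_zero]
    rw [← hend] at hAB hB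
    exact hR.add_le_vertical hv hA hB hAB
  · refine hR.add_le_chain (B := tri (a + 1)) hpos hv hfake ((hg.2 _).mpr ⟨a, rfl⟩) ?_ hA ?_ ?_
    · rw [hend]
      exact (hg.2 _).mpr ⟨a + 1, rfl⟩
    · rwa [hend]
    · rwa [hend]
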